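/- For every odd n ≥ 3, the dimension of the convex hull of the n×n VSASMs in ℝ^{n×n} equals (n−3)²/2 (a nonnegative integer since n is odd). -/

import Mathlib

/-- An `n × n` alternating sign matrix: entries in `{-1, 0, 1}`, all row- and
column-prefix sums lie in `{0, 1}`, and all full row and column sums equal `1`. -/
def IsASM (n : ℕ) (X : Fin n → Fin n → ℝ) : Prop :=
  (∀ i j, X i j = -1 ∨ X i j = 0 ∨ X i j = 1) ∧
  (∀ i j, (∑ j' ∈ Finset.Iic j, X i j') = 0 ∨ (∑ j' ∈ Finset.Iic j, X i j') = 1) ∧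
  (∀ i j, (∑ i' ∈ Finset.Iic i, X i' j) = 0 ∨ (∑ i' ∈ Finset.Iic i, X i' j) = 1) ∧
  (∀ i, (∑ j, X i j) = 1) ∧
  (∀ j, (∑ i, X i j) = 1)

/-- The entries of a matrix, extended by zero to all natural indices. -/
def natEntry {n : ℕ} (X : Fin n → Fin n → ℝ) (a b : ℕ) : ℝ :=
  if h : a < n ∧ b < n then X ⟨a, h.1⟩ ⟨b, h.2⟩ else 0

/-- The sum of the entries in the first `i` rows and `j` columns. -/
def cornerSum (n i j : ℕ) : (Fin n → Fin n → ℝ) →ₗ[ℝ] ℝ where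
  toFun X := ∑ a ∈ Finset.range i, ∑ b ∈ Finset.range j, natEntry X a b
  map_add' X Y := by
    simp only [← Finset.sum_add_distrib]
    refine Finset.sum_congr rfl fun a _ => Finset.sum_congr rfl fun b _ => ?_
    unfold natEntry
    split_ifs <;> simp
  map_smul' r X := by
    simp only [Finset.smul_sum, RingHom.id_apply]
    refine Finset.sum_congr rfl fun a _ => Finset.sum_congr rfl fun b _ => ?_
    unfold natEntry
    split_ifs <;> simp

theorem cornerSum_apply {n : ℕ} (i j : ℕ) (X : Fin n → Fin n → ℝ) :
    cornerSum n i j X = ∑ a ∈ Finset.range i, ∑ b ∈ Finset.range j, natEntry X a b := rfl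

theorem cornerSum_zero_left {n : ℕ} (j : ℕ) (X : Fin n → Fin n → ℝ) :
    cornerSum n 0 j X = 0 := by
  simp [cornerSum_apply]

theorem cornerSum_zero_right {n : ℕ} (i : ℕ) (X : Fin n → Fin n → ℝ) :
    cornerSum n i 0 X = 0 := by
  simp [cornerSum_apply]

theorem cornerSum_succ_left {n : ℕ} (i j : ℕ) (X : Fin n → Fin n → ℝ) :
    cornerSum n (i + 1) j X = cornerSum n i j X + ∑ b ∈ Finset.range j, natEntry X i b := by
  simp [cornerSum_apply, Finset.sum_range_succ]

theorem cornerSum_succ_right {n : ℕ} (i j : ℕ) (X : Fin n → Fin n → ℝ) :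
    cornerSum n i (j + 1) X = cornerSum n i j X + ∑ a ∈ Finset.range i, natEntry X a j := by
  simp [cornerSum_apply, Finset.sum_range_succ, Finset.sum_add_distrib]

theorem Fin.sum_Iic_eq_sum_range {n : ℕ} (f : ℕ → ℝ) (j : Fin n) :
    ∑ k ∈ Finset.Iic j, f k = ∑ k ∈ Finset.range (j + 1), f k := by
  refine Finset.sum_bij (fun k _ => (k : ℕ)) ?_ ?_ ?_ ?_
  · intro k hk
    have := Fin.le_def.1 (Finset.mem_Iic.1 hk)
    exact Finset.mem_range.2 (by omega)
  · intro a _ b _ h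
    exact Fin.ext h
  · intro b hb
    have hb' := Finset.mem_range.1 hb
    exact ⟨⟨b, by omega⟩, Finset.mem_Iic.2 (Fin.le_def.2 (by simp; omega)), rfl⟩
  · intros
    rfl

theorem natEntry_coe {n : ℕ} (X : Fin n → Fin n → ℝ) (i j : Fin n) :
    natEntry X i j = X i j := by
  simp [natEntry]

theorem eq_cornerSum {n : ℕ} (X : Fin n → Fin n → ℝ) (i j : Fin n) :
    X i j = cornerSum n (i + 1) (j + 1) X - cornerSum n i (j + 1) X
      - cornerSum n (i + 1) j X + cornerSum n i j X := by
  rw [cornerSum_succ_left, cornerSum_succ_left, Finset.sum_range_succ, natEntry_coe]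
  ring

/-- The matrix with prescribed corner sums `h`. -/
def ofHeight (n : ℕ) (h : ℕ → ℕ → ℤ) (i j : Fin n) : ℝ :=
  ((h (i + 1) (j + 1) - h i (j + 1) - h (i + 1) j + h i j : ℤ) : ℝ)

theorem natEntry_ofHeight {n : ℕ} (h : ℕ → ℕ → ℤ) {a b : ℕ} (ha : a < n) (hb : b < n) :
    natEntry (ofHeight n h) a b =
      ((h (a + 1) (b + 1) - h a (b + 1) - h (a + 1) b + h a b : ℤ) : ℝ) := by
  simp [natEntry, ha, hb, ofHeight]

theorem sum_row_ofHeight {n : ℕ} (h : ℕ → ℕ → ℤ) (h0 : ∀ i ≤ n, h i 0 = 0) {a : ℕ} (ha : a < n)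
    (j : ℕ) (hj : j ≤ n) :
    ∑ b ∈ Finset.range j, natEntry (ofHeight n h) a b = ((h (a + 1) j - h a j : ℤ) : ℝ) := by
  induction j with
  | zero => simp [h0 a ha.le, h0 (a + 1) ha]
  | succ j ih =>
    rw [Finset.sum_range_succ, ih (by omega), natEntry_ofHeight h ha (by omega)]
    push_cast
    ring

theorem sum_col_ofHeight {n : ℕ} (h : ℕ → ℕ → ℤ) (h0' : ∀ j, h 0 j = 0) {b : ℕ} (hb : b < n)
    (i : ℕ) (hi : i ≤ n) :
    ∑ a ∈ Finset.range i, natEntry (ofHeight n h) a b = ((h i (b + 1) - h i b : ℤ) : ℝ) := by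
  induction i with
  | zero => simp [h0']
  | succ i ih =>
    rw [Finset.sum_range_succ, ih (by omega), natEntry_ofHeight h (by omega) hb]
    push_cast
    ring

theorem cornerSum_ofHeight {n : ℕ} (h : ℕ → ℕ → ℤ) (h0 : ∀ i ≤ n, h i 0 = 0)
    (h0' : ∀ j, h 0 j = 0) (i j : ℕ) (hi : i ≤ n) (hj : j ≤ n) :
    cornerSum n i j (ofHeight n h) = (h i j : ℝ) := by
  induction i with
  | zero => simp [cornerSum_zero_left, h0']
  | succ i ih =>
    rw [cornerSum_succ_left, ih (by omega), sum_row_ofHeight h h0 (by omega) j hj]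
    push_cast
    ring

theorem sum_row_Iic {n : ℕ} (X : Fin n → Fin n → ℝ) (i j : Fin n) :
    ∑ k ∈ Finset.Iic j, X i k = ∑ b ∈ Finset.range (j + 1), natEntry X i b := by
  simp only [← Fin.sum_Iic_eq_sum_range, natEntry_coe]

theorem sum_col_Iic {n : ℕ} (X : Fin n → Fin n → ℝ) (i j : Fin n) :
    ∑ k ∈ Finset.Iic i, X k j = ∑ a ∈ Finset.range (i + 1), natEntry X a j := by
  rw [← Fin.sum_Iic_eq_sum_range (fun a => natEntry X a j)]
  simp only [natEntry_coe]

theorem sum_row_univ {n : ℕ} (X : Fin n → Fin n → ℝ) (i : Fin n) :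
    ∑ k, X i k = ∑ b ∈ Finset.range n, natEntry X i b := by
  rw [Finset.sum_range]
  simp only [natEntry_coe]

theorem sum_col_univ {n : ℕ} (X : Fin n → Fin n → ℝ) (j : Fin n) :
    ∑ k, X k j = ∑ a ∈ Finset.range n, natEntry X a j := by
  rw [Finset.sum_range]
  simp only [natEntry_coe]

theorem isASM_ofHeight {n : ℕ} (h : ℕ → ℕ → ℤ) (h0 : ∀ i ≤ n, h i 0 = 0) (h0' : ∀ j, h 0 j = 0)
    (hrow : ∀ i ≤ n, h i n = i) (hcol : ∀ j ≤ n, h n j = j)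
    (hstep : ∀ i < n, ∀ j ≤ n, h (i + 1) j - h i j = 0 ∨ h (i + 1) j - h i j = 1)
    (hstep' : ∀ i ≤ n, ∀ j < n, h i (j + 1) - h i j = 0 ∨ h i (j + 1) - h i j = 1) :
    IsASM n (ofHeight n h) := by
  refine ⟨?_, ?_, ?_, ?_, ?_⟩
  · intro i j
    have h1 := hstep i i.2 (j + 1) j.2
    have h2 := hstep i i.2 j j.2.le
    have h3 : h (i + 1) (j + 1) - h i (j + 1) - h (i + 1) j + h i j = -1 ∨
      h (i + 1) (j + 1) - h i (j + 1) - h (i + 1) j + h i j = 0 ∨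
      h (i + 1) (j + 1) - h i (j + 1) - h (i + 1) j + h i j = 1 := by omega
    unfold ofHeight
    exact_mod_cast h3
  · intro i j
    rw [sum_row_Iic, sum_row_ofHeight h h0 i.2 _ j.2]
    exact_mod_cast hstep i i.2 (j + 1) j.2
  · intro i j
    rw [sum_col_Iic, sum_col_ofHeight h h0' j.2 _ i.2]
    exact_mod_cast hstep' (i + 1) i.2 j j.2
  · intro i
    rw [sum_row_univ, sum_row_ofHeight h h0 i.2 _ le_rfl, hrow _ i.2, hrow _ i.2.le]
    simp
  · intro j
    rw [sum_col_univ, sum_col_ofHeight h h0' j.2 _ le_rfl, hcol _ j.2, hcol _ j.2.le]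
    simp

/-- The set of vertically symmetric alternating sign matrices. -/
def vsasm (n : ℕ) : Set (Fin n → Fin n → ℝ) :=
  {X | IsASM n X ∧ ∀ i j, X i j = X i j.rev}

/-- The reflection of a left-half height function to all columns. -/
def reflectHeight (m : ℕ) (g : ℕ → ℕ → ℕ) (i j : ℕ) : ℤ :=
  if j ≤ m then (g i j : ℤ) else (i : ℤ) - g i (2 * m + 1 - j)

theorem ofHeight_reflectHeight_mem {m : ℕ} (g : ℕ → ℕ → ℕ)
    (h0 : ∀ i ≤ 2 * m + 1, g i 0 = 0) (h0' : ∀ j ≤ m, g 0 j = 0)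
    (hmid : ∀ i ≤ 2 * m + 1, g i m = i / 2) (hcol : ∀ j ≤ m, g (2 * m + 1) j = j)
    (hstep : ∀ i < 2 * m + 1, ∀ j ≤ m, g (i + 1) j = g i j ∨ g (i + 1) j = g i j + 1)
    (hstep' : ∀ i ≤ 2 * m + 1, ∀ j < m, g i (j + 1) = g i j ∨ g i (j + 1) = g i j + 1) :
    ofHeight (2 * m + 1) (reflectHeight m g) ∈ vsasm (2 * m + 1) ∧
    ∀ i j, i ≤ 2 * m + 1 → j ≤ m →
      cornerSum (2 * m + 1) i j (ofHeight (2 * m + 1) (reflectHeight m g)) = g i j := by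
  set h := reflectHeight m g with hh
  have left : ∀ i j, j ≤ m → h i j = g i j := fun i j hj => by simp [hh, reflectHeight, hj]
  have right : ∀ i j, m < j → h i j = (i : ℤ) - g i (2 * m + 1 - j) := fun i j hj => by
    simp [hh, reflectHeight, hj.not_ge]
  have hz : ∀ i ≤ 2 * m + 1, h i 0 = 0 := fun i hi => by simp [left, h0 i hi]
  have hz' : ∀ j, h 0 j = 0 := by
    intro j
    rcases le_or_gt j m with hj | hj
    · simp [left 0 j hj, h0' j hj]
    · simp [right 0 j hj, h0' (2 * m + 1 - j) (by omega)]
  refine ⟨⟨isASM_ofHeight h hz hz' ?_ ?_ ?_ ?_, ?_⟩, ?_⟩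
  · intro i hi
    simp [right i (2 * m + 1) (by omega), h0 i hi]
  · intro j hj
    rcases le_or_gt j m with hjm | hjm
    · rw [left _ j hjm, hcol j hjm]
    · rw [right _ j hjm, hcol _ (by omega)]
      omega
  · intro i hi j hj
    rcases le_or_gt j m with hjm | hjm
    · rw [left _ j hjm, left _ j hjm]
      have := hstep i hi j hjm
      omega
    · rw [right _ j hjm, right _ j hjm]
      have := hstep i hi (2 * m + 1 - j) (by omega)
      omega
  · intro i hi j hj
    rcases lt_trichotomy j m with hjm | rfl | hjm
    · rw [left _ j hjm.le, left _ (j + 1) hjm]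
      have := hstep' i hi j hjm
      omega
    · rw [left _ j le_rfl, right _ (j + 1) (by omega),
        show 2 * j + 1 - (j + 1) = j by omega, hmid i hi]
      omega
    · rw [right _ j hjm, right _ (j + 1) (by omega)]
      have := hstep' i hi (2 * m + 1 - (j + 1)) (by omega)
      rw [show 2 * m + 1 - (j + 1) + 1 = 2 * m + 1 - j by omega] at this
      omega
  · have reflect : ∀ i j, i ≤ 2 * m + 1 → j ≤ 2 * m + 1 →
        h i j = (i : ℤ) - h i (2 * m + 1 - j) := by
      intro i j hi hj
      rcases le_or_gt j m with hjm | hjm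
      · rw [left i j hjm, right i (2 * m + 1 - j) (by omega),
          show 2 * m + 1 - (2 * m + 1 - j) = j by omega]
        ring
      · rw [right i j hjm, left i (2 * m + 1 - j) (by omega)]
    intro i j
    have hi := i.2
    have hj := j.2
    unfold ofHeight
    rw [reflect (i + 1) (j + 1) (by omega) (by omega), reflect i (j + 1) (by omega) (by omega),
      reflect (i + 1) j (by omega) (by omega), reflect i j (by omega) (by omega), Fin.val_rev,
      show 2 * m + 1 - (j : ℕ) = 2 * m + 1 - (j + 1) + 1 by omega]
    push_cast
    ring
  · intro i j hi hj
    rw [cornerSum_ofHeight h hz hz' i j hi (by omega), left i j hj]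
    simp

/-- The least left-half height function whose value at `(i₀, j₀)` is not minimal. -/
def raisedHeight (m i₀ j₀ i j : ℕ) : ℕ :=
  max (i / 2 + j - m) (i₀ / 2 + j₀ - m + 1 - (i₀ - i) - (j₀ - j))

theorem raisedHeight_step_left (m i₀ j₀ i j : ℕ) :
    raisedHeight m i₀ j₀ (i + 1) j = raisedHeight m i₀ j₀ i j ∨
      raisedHeight m i₀ j₀ (i + 1) j = raisedHeight m i₀ j₀ i j + 1 := by
  unfold raisedHeight
  omega

theorem raisedHeight_step_right (m i₀ j₀ i j : ℕ) :
    raisedHeight m i₀ j₀ i (j + 1) = raisedHeight m i₀ j₀ i j ∨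
      raisedHeight m i₀ j₀ i (j + 1) = raisedHeight m i₀ j₀ i j + 1 := by
  unfold raisedHeight
  omega

theorem raisedHeight_self (m i₀ j₀ : ℕ) :
    raisedHeight m i₀ j₀ i₀ j₀ = i₀ / 2 + j₀ - m + 1 := by
  unfold raisedHeight
  omega

theorem raisedHeight_below (m i₀ j₀ : ℕ) :
    raisedHeight m i₀ j₀ (i₀ + 1) j₀ = i₀ / 2 + j₀ - m + 1 := by
  unfold raisedHeight
  omega

theorem raisedHeight_right (m i₀ j₀ : ℕ) :
    raisedHeight m i₀ j₀ i₀ (j₀ + 1) = i₀ / 2 + j₀ - m + 1 := by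
  unfold raisedHeight
  omega

theorem raisedHeight_above {m i₀ j₀ i : ℕ} (h : i + 1 = i₀) :
    raisedHeight m i₀ j₀ i j₀ = i₀ / 2 + j₀ - m := by
  unfold raisedHeight
  omega

theorem raisedHeight_left {m i₀ j₀ j : ℕ} (h : j + 1 = j₀) :
    raisedHeight m i₀ j₀ i₀ j = i₀ / 2 + j₀ - m := by
  unfold raisedHeight
  omega

theorem raisedHeight_boundary {m i₀ j₀ : ℕ} (hi : 2 ≤ i₀) (hi' : i₀ < 2 * m) (hj : 1 ≤ j₀)
    (hj' : j₀ < m) :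
    (∀ i ≤ 2 * m + 1, raisedHeight m i₀ j₀ i 0 = 0) ∧ (∀ j ≤ m, raisedHeight m i₀ j₀ 0 j = 0) ∧
    (∀ i ≤ 2 * m + 1, raisedHeight m i₀ j₀ i m = i / 2) ∧
    (∀ j ≤ m, raisedHeight m i₀ j₀ (2 * m + 1) j = j) := by
  unfold raisedHeight
  refine ⟨fun i h => ?_, fun j h => ?_, fun i h => ?_, fun j h => ?_⟩
  · omega
  · omega
  · omega
  · omega

theorem exists_vsasm_cornerSum_sub {m i₀ j₀ : ℕ} (hi : 2 ≤ i₀) (hi' : i₀ < 2 * m) (hj : 1 ≤ j₀)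
    (hj' : j₀ < m) :
    ∃ X ∈ vsasm (2 * m + 1), ∃ Y ∈ vsasm (2 * m + 1), ∀ i j, i ≤ 2 * m + 1 → j ≤ m →
      cornerSum (2 * m + 1) i j (X - Y) = if i = i₀ ∧ j = j₀ then 1 else 0 := by
  set g : ℕ → ℕ → ℕ := raisedHeight m i₀ j₀
  set g' : ℕ → ℕ → ℕ := fun i j => g i j - if i = i₀ ∧ j = j₀ then 1 else 0 with hg'
  have self : g i₀ j₀ = i₀ / 2 + j₀ - m + 1 := raisedHeight_self m i₀ j₀
  have g'_self : g' i₀ j₀ = i₀ / 2 + j₀ - m := by simp [hg', self]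
  have g'_of_ne : ∀ i j, ¬(i = i₀ ∧ j = j₀) → g' i j = g i j := fun i j h => by simp [hg', h]
  obtain ⟨b₁, b₂, b₃, b₄⟩ := raisedHeight_boundary hi hi' hj hj'
  obtain ⟨hX, hX'⟩ := ofHeight_reflectHeight_mem (m := m) g b₁ b₂ b₃ b₄
    (fun i _ j _ => raisedHeight_step_left m i₀ j₀ i j)
    (fun i _ j _ => raisedHeight_step_right m i₀ j₀ i j)
  obtain ⟨hY, hY'⟩ := ofHeight_reflectHeight_mem (m := m) g'
    (fun i h => (g'_of_ne i 0 (by omega)).trans (b₁ i h))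
    (fun j h => (g'_of_ne 0 j (by omega)).trans (b₂ j h))
    (fun i h => (g'_of_ne i m (by omega)).trans (b₃ i h))
    (fun j h => (g'_of_ne _ j (by omega)).trans (b₄ j h))
    (fun i _ j _ => by
      by_cases h₁ : i = i₀ ∧ j = j₀
      · obtain ⟨rfl, rfl⟩ := h₁
        rw [g'_self, g'_of_ne _ _ (by omega)]
        exact Or.inr (raisedHeight_below m i j)
      by_cases h₂ : i + 1 = i₀ ∧ j = j₀
      · obtain ⟨h₂, rfl⟩ := h₂
        rw [g'_of_ne i j h₁, h₂, g'_self]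
        exact Or.inl (raisedHeight_above h₂).symm
      rw [g'_of_ne i j h₁, g'_of_ne _ j h₂]
      exact raisedHeight_step_left m i₀ j₀ i j)
    (fun i _ j _ => by
      by_cases h₁ : i = i₀ ∧ j = j₀
      · obtain ⟨rfl, rfl⟩ := h₁
        rw [g'_self, g'_of_ne _ _ (by omega)]
        exact Or.inr (raisedHeight_right m i j)
      by_cases h₂ : i = i₀ ∧ j + 1 = j₀
      · obtain ⟨rfl, h₂⟩ := h₂
        rw [g'_of_ne i j h₁, h₂, g'_self]
        exact Or.inl (raisedHeight_left h₂).symm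
      rw [g'_of_ne i j h₁, g'_of_ne i _ h₂]
      exact raisedHeight_step_right m i₀ j₀ i j)
  refine ⟨_, hX, _, hY, fun i j hi hj => ?_⟩
  rw [map_sub, hX' i j hi hj, hY' i j hi hj]
  split_ifs with hij
  · rw [hij.1, hij.2, g'_self, self]
    push_cast
    ring
  · rw [g'_of_ne i j hij, sub_self]

theorem cornerSum_step_left {n : ℕ} {X : Fin n → Fin n → ℝ} (hX : IsASM n X) {i j : ℕ}
    (hi : i < n) (hj : j ≤ n) :
    cornerSum n (i + 1) j X = cornerSum n i j X ∨
      cornerSum n (i + 1) j X = cornerSum n i j X + 1 := by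
  rcases j with _ | j
  · simp [cornerSum_zero_right]
  · have := hX.2.1 ⟨i, hi⟩ ⟨j, hj⟩
    rw [sum_row_Iic] at this
    rw [cornerSum_succ_left]
    rcases this with h | h <;> simp only at h <;> simp [h]

theorem cornerSum_step_right {n : ℕ} {X : Fin n → Fin n → ℝ} (hX : IsASM n X) {i j : ℕ}
    (hi : i ≤ n) (hj : j < n) :
    cornerSum n i (j + 1) X = cornerSum n i j X ∨
      cornerSum n i (j + 1) X = cornerSum n i j X + 1 := by
  rcases i with _ | i
  · simp [cornerSum_zero_left]
  · have := hX.2.2.1 ⟨i, hi⟩ ⟨j, hj⟩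
    rw [sum_col_Iic] at this
    rw [cornerSum_succ_right]
    rcases this with h | h <;> simp only at h <;> simp [h]

theorem cornerSum_full_left {n : ℕ} {X : Fin n → Fin n → ℝ} (hX : IsASM n X) (j : ℕ)
    (hj : j ≤ n) : cornerSum n n j X = j := by
  induction j with
  | zero => simp [cornerSum_zero_right]
  | succ j ih =>
    have := hX.2.2.2.2 ⟨j, hj⟩
    rw [sum_col_univ] at this
    rw [cornerSum_succ_right, ih (by omega), this]
    simp

theorem cornerSum_full_right {n : ℕ} {X : Fin n → Fin n → ℝ} (hX : IsASM n X) (i : ℕ)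
    (hi : i ≤ n) : cornerSum n i n X = i := by
  induction i with
  | zero => simp [cornerSum_zero_left]
  | succ i ih =>
    have := hX.2.2.2.1 ⟨i, hi⟩
    rw [sum_row_univ] at this
    rw [cornerSum_succ_left, ih (by omega), this]
    simp

theorem cornerSum_reflect {n : ℕ} {X : Fin n → Fin n → ℝ} (hX : X ∈ vsasm n) {i : ℕ}
    (hi : i ≤ n) (j : ℕ) (hj : j ≤ n) :
    cornerSum n i j X + cornerSum n i (n - j) X = i := by
  induction j with
  | zero => simp [cornerSum_zero_right, cornerSum_full_right hX.1 i hi]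
  | succ j ih =>
    have h1 := ih (by omega)
    have h2 : n - j = (n - (j + 1)) + 1 := by omega
    rw [h2, cornerSum_succ_right] at h1
    rw [cornerSum_succ_right]
    have h3 : ∀ a, natEntry X a j = natEntry X a (n - (j + 1)) := by
      intro a
      unfold natEntry
      by_cases ha : a < n
      · have hj' : j < n := hj
        have hj'' : n - (j + 1) < n := by omega
        rw [dif_pos ⟨ha, hj'⟩, dif_pos ⟨ha, hj''⟩, hX.2]
        rfl
      · simp [ha]
    simp only [h3]
    linarith

theorem cornerSum_middle {m : ℕ} {X : Fin (2 * m + 1) → Fin (2 * m + 1) → ℝ}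
    (hX : X ∈ vsasm (2 * m + 1)) (i : ℕ) (hi : i ≤ 2 * m + 1) :
    cornerSum (2 * m + 1) i m X = ((i / 2 : ℕ) : ℝ) := by
  induction i with
  | zero => simp [cornerSum_zero_left]
  | succ i ih =>
    have h1 := ih (by omega)
    have h2 := cornerSum_step_left hX.1 (i := i) (j := m) (by omega) (by omega)
    have h3 := cornerSum_step_right hX.1 (i := i + 1) (j := m) hi (by omega)
    have h4 := cornerSum_reflect hX hi m (by omega)
    rw [show 2 * m + 1 - m = m + 1 by omega] at h4
    rw [h1] at h2
    generalize cornerSum (2 * m + 1) (i + 1) m X = x at *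
    generalize cornerSum (2 * m + 1) (i + 1) (m + 1) X = y at *
    rcases h2 with rfl | rfl <;> rcases h3 with rfl | rfl <;> norm_cast at * <;> omega

theorem cornerSum_one {m : ℕ} {X : Fin (2 * m + 1) → Fin (2 * m + 1) → ℝ}
    (hX : X ∈ vsasm (2 * m + 1)) (j : ℕ) (hj : j ≤ m) :
    cornerSum (2 * m + 1) 1 j X = 0 := by
  have hle : cornerSum (2 * m + 1) 1 j X ≤ 0 := by
    induction hj using Nat.decreasingInduction with
    | self => simp [cornerSum_middle hX 1 (by omega)]
    | of_succ k hk ih =>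
      rcases cornerSum_step_right hX.1 (i := 1) (j := k) (by omega) (by omega) with h | h <;>
        linarith
  rcases cornerSum_step_left hX.1 (i := 0) (j := j) (by omega) (by omega) with h | h <;>
    rw [cornerSum_zero_left, zero_add] at h <;> linarith

theorem cornerSum_penultimate {m : ℕ} {X : Fin (2 * m + 1) → Fin (2 * m + 1) → ℝ}
    (hX : X ∈ vsasm (2 * m + 1)) (j : ℕ) (hj : j ≤ m) :
    cornerSum (2 * m + 1) (2 * m) j X = j := by
  have hle : (j : ℝ) ≤ cornerSum (2 * m + 1) (2 * m) j X := by
    induction hj using Nat.decreasingInduction with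
    | self => simp [cornerSum_middle hX (2 * m) (by omega)]
    | of_succ k hk ih =>
      push_cast at ih
      rcases cornerSum_step_right hX.1 (i := 2 * m) (j := k) (by omega) (by omega) with h | h <;>
        linarith
  rcases cornerSum_step_left hX.1 (i := 2 * m) (j := j) (by omega) (by omega) with h | h <;>
    rw [cornerSum_full_left hX.1 j (by omega)] at h <;> linarith

theorem vectorSpan_le_ker {E : Type*} [AddCommGroup E] [Module ℝ E] {s : Set E} (l : E →ₗ[ℝ] ℝ)
    (h : ∀ x ∈ s, ∀ y ∈ s, l x = l y) : vectorSpan ℝ s ≤ LinearMap.ker l := by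
  rw [vectorSpan_def, Submodule.span_le]
  rintro _ ⟨x, hx, y, hy, rfl⟩
  simp [h x hx y hy]

theorem eq_zero_of_mem_vectorSpan_vsasm {m : ℕ} {D : Fin (2 * m + 1) → Fin (2 * m + 1) → ℝ}
    (hD : D ∈ vectorSpan ℝ (vsasm (2 * m + 1)))
    (h : ∀ i j, 2 ≤ i → i < 2 * m → 1 ≤ j → j < m → cornerSum (2 * m + 1) i j D = 0) : D = 0 := by
  have half : ∀ i j, i ≤ 2 * m + 1 → j ≤ m → cornerSum (2 * m + 1) i j D = 0 := by
    intro i j hi hj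
    by_cases hin : 2 ≤ i ∧ i < 2 * m ∧ 1 ≤ j ∧ j < m
    · exact h i j hin.1 hin.2.1 hin.2.2.1 hin.2.2.2
    refine vectorSpan_le_ker (cornerSum (2 * m + 1) i j) (fun X hX Y hY => ?_) hD
    have hc : i = 0 ∨ i = 1 ∨ i = 2 * m ∨ i = 2 * m + 1 ∨ j = 0 ∨ j = m := by omega
    rcases hc with rfl | rfl | rfl | rfl | rfl | rfl
    · simp only [cornerSum_zero_left]
    · rw [cornerSum_one hX j hj, cornerSum_one hY j hj]
    · rw [cornerSum_penultimate hX j hj, cornerSum_penultimate hY j hj]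
    · rw [cornerSum_full_left hX.1 j (by omega), cornerSum_full_left hY.1 j (by omega)]
    · simp only [cornerSum_zero_right]
    · rw [cornerSum_middle hX i hi, cornerSum_middle hY i hi]
  have full : ∀ i j, i ≤ 2 * m + 1 → j ≤ 2 * m + 1 → cornerSum (2 * m + 1) i j D = 0 := by
    intro i j hi hj
    by_cases hjm : j ≤ m
    · exact half i j hi hjm
    have := vectorSpan_le_ker
      (cornerSum (2 * m + 1) i j + cornerSum (2 * m + 1) i (2 * m + 1 - j))
      (fun X hX Y hY => by
        simp only [LinearMap.add_apply]
        rw [cornerSum_reflect hX hi j hj, cornerSum_reflect hY hi j hj]) hD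
    rw [LinearMap.mem_ker, LinearMap.add_apply, half i (2 * m + 1 - j) hi (by omega)] at this
    simpa using this
  ext i j
  rw [eq_cornerSum D i j, full _ _ i.2 j.2, full _ _ i.2.le j.2, full _ _ i.2 j.2.le,
    full _ _ i.2.le j.2.le]
  simp

/-- The corner sums of `X` at the positions not determined by vertical symmetry. -/
def freeCornerSums (k : ℕ) :
    (Fin (2 * (k + 1) + 1) → Fin (2 * (k + 1) + 1) → ℝ) →ₗ[ℝ] (Fin (2 * k) × Fin k → ℝ) :=
  LinearMap.pi fun p => cornerSum (2 * (k + 1) + 1) (p.1 + 2) (p.2 + 1)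

theorem finrank_vectorSpan_vsasm (k : ℕ) :
    Module.finrank ℝ (vectorSpan ℝ (vsasm (2 * (k + 1) + 1))) = 2 * k * k := by
  set V := vectorSpan ℝ (vsasm (2 * (k + 1) + 1)) with hV
  have hinj : Function.Injective ((freeCornerSums k).domRestrict V) := by
    rw [← LinearMap.ker_eq_bot, LinearMap.ker_eq_bot']
    rintro ⟨D, hD⟩ h
    refine Subtype.ext (eq_zero_of_mem_vectorSpan_vsasm hD fun i j hi hi' hj hj' => ?_)
    have := congrFun h (⟨i - 2, by omega⟩, ⟨j - 1, by omega⟩)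
    simpa [freeCornerSums, Nat.sub_add_cancel hi, Nat.sub_add_cancel hj] using this
  have hsurj : Function.Surjective ((freeCornerSums k).domRestrict V) := by
    have hex : ∀ p : Fin (2 * k) × Fin k,
        ∃ d : V, (freeCornerSums k).domRestrict V d = Pi.single p 1 := by
      rintro ⟨a, b⟩
      obtain ⟨X, hX, Y, hY, hXY⟩ := exists_vsasm_cornerSum_sub (m := k + 1) (i₀ := a + 2)
        (j₀ := b + 1) (by omega) (by omega) (by omega) (by omega)
      refine ⟨⟨X - Y, vsub_mem_vectorSpan ℝ hX hY⟩, ?_⟩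
      ext ⟨c, d⟩
      have := hXY (c + 2) (d + 1) (by omega) (by omega)
      simpa [freeCornerSums, Pi.single_apply, Prod.ext_iff, Fin.ext_iff] using this
    choose d hd using hex
    intro y
    refine ⟨∑ p, y p • d p, ?_⟩
    rw [map_sum]
    simp only [map_smul, hd]
    ext q
    simp [Finset.sum_apply, Pi.single_apply]
  rw [(LinearEquiv.ofBijective _ ⟨hinj, hsurj⟩).finrank_eq]
  simp

/-- The dimension of the polytope of `n × n` vertically symmetric ASMs is `(n-3)²/2`. -/
theorem VSASM_polytope_dim (n : ℕ) (hodd : Odd n) (hn : 3 ≤ n) :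
    Module.finrank ℝ
        ↥(vectorSpan ℝ
          (convexHull ℝ {X : Fin n → Fin n → ℝ | IsASM n X ∧ ∀ i j, X i j = X i j.rev}))
      = (n - 3) ^ 2 / 2 := by
  rw [← direction_affineSpan, affineSpan_convexHull, direction_affineSpan]
  obtain ⟨k, rfl⟩ : ∃ k, n = 2 * (k + 1) + 1 := by
    obtain ⟨r, rfl⟩ := hodd
    exact ⟨r - 1, by omega⟩
  refine (finrank_vectorSpan_vsasm k).trans ?_
  rw [show 2 * (k + 1) + 1 - 3 = 2 * k by omega, show (2 * k) ^ 2 = 2 * k * k * 2 by ring]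
  simp
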